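/- Let σ be the uniform probability measure on the unit sphere of ℝ³. Then for all a, b ≥ 0, Ψ_{σσ}(a,b) = Φ_{σσ}(a,b) = (a²b²/4) · ( (a + b − ab)₊² − (|a − b| − ab)₊² ). In particular Ψ_{σσ} is C¹ on [0,∞)² and there is a constant C such that |∇Ψ_{σσ}(a,b)| ≤ C (a²b³ + a³b²) for all a,b ≥ 0. -/

import Mathlib

open MeasureTheory ENNReal Set Metric Filter Real Topology
open scoped RealInnerProductSpace

noncomputable section

/-- Three-dimensional Euclidean space. -/
abbrev E3 := EuclideanSpace ℝ (Fin 3)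

/-- The Coulomb kernel `|x-y|⁻¹`, valued in `ℝ≥0∞` (equal to `∞` on the diagonal). -/
def coul (x y : E3) : ℝ≥0∞ := (ENNReal.ofReal ‖x - y‖)⁻¹

/-- The Coulomb energy `D(ν₁,ν₂) = (1/2)∬ |x-y|⁻¹ dν₁ dν₂`, valued in `ℝ≥0∞`. -/
def DD (ν₁ ν₂ : Measure E3) : ℝ≥0∞ := 2⁻¹ * ∫⁻ x, ∫⁻ y, coul x y ∂ν₂ ∂ν₁

/-- The real-valued Coulomb energy `D(ν₁,ν₂)`. -/
def Dr (ν₁ ν₂ : Measure E3) : ℝ := (DD ν₁ ν₂).toReal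

/-- A measure on `ℝ³` is radial if it is invariant under all linear isometries
(rotations about the origin). -/
def IsRadial (μ : Measure E3) : Prop := ∀ e : E3 ≃ₗᵢ[ℝ] E3, Measure.map e μ = μ

/-- `μ_{v,a}` : the measure `μ` dilated by `1/a` and recentered at `v`, i.e. the pushforward
of `μ` under `u ↦ v + u/a`. -/
def dilate (μ : Measure E3) (v : E3) (a : ℝ) : Measure E3 :=
  Measure.map (fun u => v + a⁻¹ • u) μ

/-- The first basis vector `e₁ = (1,0,0)`. -/
def e1 : E3 := EuclideanSpace.single (0 : Fin 3) (1 : ℝ)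

/-- `Φ_{μν}(a,b) = a³b³(1 - 2D(μ_{0,a}, ν_{e₁,b}))`, extended by `0` when `a = 0` or `b = 0`. -/
def Phi (μ ν : Measure E3) (a b : ℝ) : ℝ :=
  if 0 < a ∧ 0 < b then a ^ 3 * b ^ 3 * (1 - 2 * Dr (dilate μ 0 a) (dilate ν e1 b)) else 0

/-- `Ψ_{μν} = Φ_{μν} + Φ_{νμ} - Φ_{νν}`. -/
def Psi (μ ν : Measure E3) (a b : ℝ) : ℝ := Phi μ ν a b + Phi ν μ a b - Phi ν ν a b

/-- The uniform (normalized Hausdorff) probability measure on the unit sphere of `ℝ³`. -/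
def sphereM : Measure E3 :=
  ((μH[2] : Measure E3) (sphere (0:E3) 1))⁻¹ • (μH[2] : Measure E3).restrict (sphere (0:E3) 1)

def sphMap (p : ℝ × ℝ) : E3 := !₂[cos p.1, sin p.1 * cos p.2, sin p.1 * sin p.2]

lemma sphMap_contDiff : ContDiff ℝ 1 sphMap := by
  unfold sphMap
  rw [contDiff_euclidean]
  intro i
  fin_cases i <;> simp <;> fun_prop

lemma sq_sum_of_mem {x : E3} (hx : x ∈ sphere (0:E3) 1) : x 0 ^ 2 + x 1 ^ 2 + x 2 ^ 2 = 1 := by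
  have h : ‖x‖ = 1 := by simpa using hx
  have h2 := EuclideanSpace.real_norm_sq_eq x
  rw [h] at h2
  simp [Fin.sum_univ_three] at h2
  linarith

lemma sphere_subset : sphere (0:E3) 1 ⊆ sphMap '' (Icc (-π) π ×ˢ Icc (-π) π) := by
  intro x hx
  have h := sq_sum_of_mem hx
  have h0 : x 0 ∈ Icc (-1:ℝ) 1 := by constructor <;> nlinarith
  have hc : cos (arccos (x 0)) = x 0 := cos_arccos h0.1 h0.2
  have hs : sin (arccos (x 0)) = √(1 - x 0 ^ 2) := sin_arccos _
  set z : ℂ := ⟨x 1, x 2⟩ with hz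
  have hn : ‖z‖ = √(1 - x 0 ^ 2) := by
    rw [Complex.norm_def, Complex.normSq_apply]
    congr 1
    simp [hz]; nlinarith
  refine ⟨(arccos (x 0), Complex.arg z), ⟨⟨?_, arccos_le_pi _⟩, ⟨(Complex.neg_pi_lt_arg z).le, Complex.arg_le_pi z⟩⟩, ?_⟩
  · linarith [arccos_nonneg (x 0), pi_pos]
  · have e1 := Complex.norm_mul_cos_arg z
    have e2 := Complex.norm_mul_sin_arg z
    ext i
    fin_cases i
    · simpa [sphMap] using hc
    · simp [sphMap, hs, ← hn, e1]; simp [hz]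
    · simp [sphMap, hs, ← hn, e2]; simp [hz]

lemma sphere_lt_top : (μH[2] : Measure E3) (sphere (0:E3) 1) < ∞ := by
  obtain ⟨K, hK⟩ := sphMap_contDiff.contDiffOn.exists_lipschitzOnWith (s := Icc (-π) π ×ˢ Icc (-π) π) (by norm_num)
    ((convex_Icc _ _).prod (convex_Icc _ _)) (isCompact_Icc.prod isCompact_Icc)
  refine (measure_mono sphere_subset).trans_lt ?_
  refine (hK.hausdorffMeasure_image_le (d := 2) (by norm_num)).trans_lt ?_
  rw [hausdorffMeasure_prod_real]
  refine ENNReal.mul_lt_top (by simp) ?_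
  exact (isCompact_Icc.prod isCompact_Icc).measure_lt_top

lemma sphere_pos : (μH[2] : Measure E3) (sphere (0:E3) 1) ≠ 0 := by
  intro h0
  have hL : LipschitzWith 1 (fun x : E3 => ((x 0, x 1) : ℝ × ℝ)) := by
    refine LipschitzWith.of_dist_le_mul fun x y => ?_
    simp only [NNReal.coe_one, one_mul, Prod.dist_eq]
    have key : ∀ i : Fin 3, dist (x i) (y i) ≤ dist x y := fun i => by
      rw [dist_eq_norm, dist_eq_norm]
      exact PiLp.norm_apply_le (x - y) i
    exact max_le (key 0) (key 1)
  have h1 := hL.hausdorffMeasure_image_le (d := 2) (by norm_num) (sphere (0:E3) 1)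
  rw [h0, mul_zero, hausdorffMeasure_prod_real] at h1
  have hsub : Icc (0:ℝ) (1/2) ×ˢ Icc (0:ℝ) (1/2) ⊆ (fun x : E3 => ((x 0, x 1) : ℝ × ℝ)) '' sphere (0:E3) 1 := by
    rintro ⟨p, q⟩ ⟨⟨hp, hp'⟩, ⟨hq, hq'⟩⟩
    simp only at hp hp' hq hq'
    refine ⟨!₂[p, q, √(1 - p^2 - q^2)], ?_, by simp⟩
    rw [mem_sphere_zero_iff_norm, EuclideanSpace.norm_eq, Fin.sum_univ_three]
    simp
    rw [Real.sq_sqrt (by nlinarith)]; ring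
  have h2 := (measure_mono hsub).trans h1
  rw [Measure.volume_eq_prod, Measure.prod_prod] at h2
  simp at h2

instance sphereM_prob : IsProbabilityMeasure sphereM := by
  constructor
  simp [sphereM]
  exact ENNReal.inv_mul_cancel sphere_pos sphere_lt_top.ne

lemma sphereM_radial (e : E3 ≃ₗᵢ[ℝ] E3) : MeasurePreserving e sphereM sphereM := by
  have h := e.toIsometryEquiv.measurePreserving_hausdorffMeasure 2
  have h' : MeasurePreserving e (μH[2] : Measure E3) μH[2] := h
  have h2 := h'.restrict_preimage (s := sphere (0:E3) 1) isClosed_sphere.measurableSet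
  have h3 : e ⁻¹' sphere (0:E3) 1 = sphere 0 1 := by ext; simp
  rw [h3] at h2
  exact h2.smul_measure _

lemma sphereM_ae : ∀ᵐ u ∂sphereM, ‖u‖ = 1 := by
  unfold sphereM
  refine Measure.ae_smul_measure ?_ _
  filter_upwards [ae_restrict_mem isClosed_sphere.measurableSet] with u hu
  simpa using hu

lemma exists_iso {v w : E3} (h : ‖v‖ = ‖w‖) : ∃ e : E3 ≃ₗᵢ[ℝ] E3, e v = w :=
  ⟨(ℝ ∙ (v - w))ᗮ.reflection, Submodule.reflection_sub h⟩

/-- integral over the unit ball of a zonal function -/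
def zon (g : ℝ → ℝ≥0∞) (u : E3) : ℝ≥0∞ := ∫⁻ x in ball (0:E3) 1, g (⟪u, ‖x‖⁻¹ • x⟫)

lemma zon_eq (g : ℝ → ℝ≥0∞) (hg : Measurable g) {u v : E3} (h : ‖u‖ = ‖v‖) : zon g u = zon g v := by
  obtain ⟨e, rfl⟩ := exists_iso h
  have h1 := (e.measurePreserving).restrict_preimage (s := ball (0:E3) 1) isOpen_ball.measurableSet
  have h3 : e ⁻¹' ball (0:E3) 1 = ball 0 1 := by ext; simp
  rw [h3] at h1
  unfold zon
  rw [← h1.lintegral_comp (f := fun x => g ⟪e u, ‖x‖⁻¹ • x⟫) (by fun_prop)]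
  refine lintegral_congr fun x => ?_
  rw [e.norm_map, ← e.map_smul, e.inner_map_map]

lemma sph_eq (g : ℝ → ℝ≥0∞) (hg : Measurable g) {u v : E3} (h : ‖u‖ = ‖v‖) :
    ∫⁻ x, g ⟪x, u⟫ ∂sphereM = ∫⁻ x, g ⟪x, v⟫ ∂sphereM := by
  obtain ⟨e, rfl⟩ := exists_iso h
  rw [← (sphereM_radial e).lintegral_comp (f := fun x => g ⟪x, e u⟫) (by fun_prop)]
  refine lintegral_congr fun x => ?_
  rw [e.inner_map_map]

lemma norm_e1 : ‖e1‖ = 1 := by simp [e1]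

lemma sph_zon (g : ℝ → ℝ≥0∞) (hg : Measurable g) {v : E3} (h : ‖v‖ = 1) :
    (∫⁻ x, g ⟪x, v⟫ ∂sphereM) * volume (ball (0:E3) 1) = zon g e1 := by
  have hA : ∫⁻ x in ball (0:E3) 1, ∫⁻ u, g ⟪u, ‖x‖⁻¹ • x⟫ ∂sphereM =
      (∫⁻ x, g ⟪x, v⟫ ∂sphereM) * volume (ball (0:E3) 1) := by
    rw [← setLIntegral_const]
    have h0 : ∀ᵐ x ∂(volume.restrict (ball (0:E3) 1)), x ≠ 0 :=
      ae_restrict_of_ae (Measure.ae_ne volume 0)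
    refine lintegral_congr_ae ?_
    filter_upwards [h0] with x hx
    refine sph_eq g hg ?_
    rw [h, norm_smul, norm_inv, norm_norm, inv_mul_cancel₀ (norm_ne_zero_iff.2 hx)]
  have hB : ∫⁻ u, zon g u ∂sphereM = zon g e1 := by
    have : ∫⁻ u, zon g u ∂sphereM = ∫⁻ u, zon g e1 ∂sphereM := by
      refine lintegral_congr_ae ?_
      filter_upwards [sphereM_ae] with u hu
      exact zon_eq g hg (hu.trans norm_e1.symm)
    rw [this]; simp
  rw [← hA, ← hB]
  unfold zon
  rw [lintegral_lintegral_swap]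
  refine Measurable.aemeasurable ?_
  exact hg.comp (f := fun p : E3 × E3 => ⟪p.2, ‖p.1‖⁻¹ • p.1⟫) (by fun_prop)

lemma lint_cos (g : ℝ → ℝ≥0∞) : ∫⁻ θ in Ioo 0 π, ENNReal.ofReal (sin θ) * g (cos θ) = ∫⁻ t in Ioo (-1) 1, g t := by
  have him : cos '' Ioo 0 π = Ioo (-1) 1 := by
    ext t; constructor
    · rintro ⟨θ, ⟨h1, h2⟩, rfl⟩
      constructor
      · rw [← cos_pi]; exact strictAntiOn_cos ⟨h1.le, h2.le⟩ ⟨pi_pos.le, le_rfl⟩ h2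
      · rw [← cos_zero]; exact strictAntiOn_cos ⟨le_rfl, pi_pos.le⟩ ⟨h1.le, h2.le⟩ h1
    · rintro ⟨h1, h2⟩
      exact ⟨arccos t, ⟨arccos_pos.2 h2, lt_of_le_of_ne (arccos_le_pi t) (by rw [Ne, arccos_eq_pi]; linarith)⟩, cos_arccos h1.le h2.le⟩
  rw [← him, lintegral_image_eq_lintegral_abs_deriv_mul measurableSet_Ioo
    (fun x _ => (hasDerivAt_cos x).hasDerivWithinAt) (strictAntiOn_cos.injOn.mono Ioo_subset_Icc_self)]
  refine setLIntegral_congr_fun measurableSet_Ioo fun θ hθ => ?_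
  simp only [abs_neg]
  rw [abs_of_pos (sin_pos_of_pos_of_lt_pi hθ.1 hθ.2)]

lemma lint_fin3 (F : ℝ → ℝ → ℝ → ℝ≥0∞) (hF : Measurable (fun p : ℝ × ℝ × ℝ => F p.1 p.2.1 p.2.2)) :
    ∫⁻ x : E3, F (x 0) (x 1) (x 2) = ∫⁻ x, ∫⁻ p : ℝ × ℝ, F x p.1 p.2 := by
  have h1 := PiLp.volume_preserving_ofLp (Fin 3)
  have h2 := volume_preserving_piFinSuccAbove (fun _ : Fin 3 => ℝ) 0
  have h3 := (MeasurePreserving.id (volume : Measure ℝ)).prod (volume_preserving_finTwoArrow ℝ)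
  have h4 := h3.comp (h2.comp h1)
  have h5 := h4.lintegral_comp hF
  rw [lintegral_prod _ hF.aemeasurable] at h5
  exact h5

lemma lint_polar_radial (f : ℝ → ℝ≥0∞) (hf : Measurable f) :
    ∫⁻ p : ℝ × ℝ, f (√(p.1^2 + p.2^2)) = ENNReal.ofReal (2 * π) * ∫⁻ r in Ioi 0, ENNReal.ofReal r * f r := by
  rw [← lintegral_comp_polarCoord_symm]
  have : polarCoord.target = Ioi (0:ℝ) ×ˢ Ioo (-π) π := rfl
  rw [this, Measure.volume_eq_prod, ← Measure.prod_restrict]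
  have h : ∀ᵐ p : ℝ × ℝ ∂((volume.restrict (Ioi (0:ℝ))).prod (volume.restrict (Ioo (-π) π))),
      ENNReal.ofReal p.1 • f (√((polarCoord.symm p).1^2 + (polarCoord.symm p).2^2)) = ENNReal.ofReal p.1 * f p.1 := by
    rw [Measure.prod_restrict]
    filter_upwards [ae_restrict_mem (measurableSet_Ioi.prod measurableSet_Ioo)] with p hp
    have hp1 : 0 < p.1 := hp.1
    simp only [polarCoord_symm_apply, smul_eq_mul]
    rw [show (p.1 * cos p.2)^2 + (p.1 * sin p.2)^2 = p.1^2 by nlinarith [sin_sq_add_cos_sq p.2], Real.sqrt_sq hp1.le]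
  rw [lintegral_congr_ae h, lintegral_prod _ (by fun_prop)]
  simp only [lintegral_const, Measure.restrict_apply_univ, Real.volume_Ioo]
  rw [lintegral_mul_const _ (by fun_prop), mul_comm]
  congr 2; ring

lemma zon_e1 : ∃ c : ℝ≥0∞, ∀ g : ℝ → ℝ≥0∞, Measurable g → zon g e1 = c * ∫⁻ t in Ioo (-1) 1, g t := by
  refine ⟨ENNReal.ofReal (2 * π) * ∫⁻ r in Ioi (0:ℝ), ENNReal.ofReal r * ENNReal.ofReal r * (Ioo (-1:ℝ) 1).indicator 1 r, fun g hg => ?_⟩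
  -- the profile
  set G : ℝ → ℝ → ℝ≥0∞ := fun x ρ => (Ioo (-1:ℝ) 1).indicator 1 (√(x^2 + ρ^2)) * g (x / √(x^2+ρ^2)) with hG
  have hi : Measurable ((Ioo (-1:ℝ) 1).indicator (1 : ℝ → ℝ≥0∞)) := measurable_one.indicator measurableSet_Ioo
  have hGm : Measurable (fun p : ℝ × ℝ => G p.1 p.2) := by
    simp only [hG]; fun_prop
  have s1 : zon g e1 = ∫⁻ x : E3, G (x 0) (√(x 1 ^ 2 + x 2 ^ 2)) := by
    unfold zon
    rw [← lintegral_indicator isOpen_ball.measurableSet]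
    refine lintegral_congr fun x => ?_
    have hn : √(x 0 ^ 2 + √(x 1 ^ 2 + x 2 ^ 2)^2) = ‖x‖ := by
      rw [Real.sq_sqrt (by positivity), EuclideanSpace.norm_eq, Fin.sum_univ_three]
      simp [add_assoc]
    simp only [hG, hn]
    have hb : x ∈ ball (0:E3) 1 ↔ ‖x‖ ∈ Ioo (-1:ℝ) 1 := by
      simp; intro _; linarith [norm_nonneg x]
    have hin : ⟪e1, ‖x‖⁻¹ • x⟫ = x 0 / ‖x‖ := by
      simp [e1, inner_smul_right, EuclideanSpace.inner_single_left]; ring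
    by_cases hx : x ∈ ball (0:E3) 1
    · rw [indicator_of_mem hx, indicator_of_mem (hb.1 hx), hin]; simp
    · rw [indicator_of_notMem hx, indicator_of_notMem (fun h => hx (hb.2 h))]; simp
  rw [s1, lint_fin3 (fun x y z => G x (√(y^2+z^2))) (by
    exact hGm.comp (f := fun p : ℝ × ℝ × ℝ => (p.1, √(p.2.1^2 + p.2.2^2))) (by fun_prop))]
  have s2 : ∀ x, ∫⁻ p : ℝ × ℝ, G x (√(p.1^2+p.2^2)) = ENNReal.ofReal (2 * π) * ∫⁻ r in Ioi 0, ENNReal.ofReal r * G x r :=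
    fun x => lint_polar_radial (G x) (hGm.comp (f := fun r => (x, r)) (by fun_prop))
  simp only [s2]
  rw [lintegral_const_mul' _ _ ENNReal.ofReal_ne_top, mul_assoc]
  congr 1
  have hm2 : Measurable (fun p : ℝ × ℝ => (Ioi (0:ℝ)).indicator (fun r => ENNReal.ofReal r * G p.1 r) p.2) := by
    have : (fun p : ℝ × ℝ => (Ioi (0:ℝ)).indicator (fun r => ENNReal.ofReal r * G p.1 r) p.2)
      = (Prod.snd ⁻¹' (Ioi (0:ℝ))).indicator (fun p : ℝ × ℝ => ENNReal.ofReal p.2 * G p.1 p.2) := by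
      ext p; simp [indicator]
    rw [this]
    exact Measurable.indicator (by fun_prop) (measurable_snd measurableSet_Ioi)
  have s3 : ∫⁻ x, ∫⁻ r in Ioi 0, ENNReal.ofReal r * G x r = 
      ∫⁻ p : ℝ × ℝ, (Ioi (0:ℝ)).indicator (fun r => ENNReal.ofReal r * G p.1 r) p.2 := by
    rw [Measure.volume_eq_prod, lintegral_prod _ hm2.aemeasurable]
    refine lintegral_congr fun x => ?_
    exact (lintegral_indicator measurableSet_Ioi _).symm
  rw [s3, ← lintegral_comp_polarCoord_symm]
  have : polarCoord.target = Ioi (0:ℝ) ×ˢ Ioo (-π) π := rfl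
  rw [this]
  have s4 : ∀ p ∈ Ioi (0:ℝ) ×ˢ Ioo (-π) π, ENNReal.ofReal p.1 • (Ioi (0:ℝ)).indicator (fun r => ENNReal.ofReal r * G (polarCoord.symm p).1 r) (polarCoord.symm p).2
      = (ENNReal.ofReal p.1 * ENNReal.ofReal p.1 * (Ioo (-1:ℝ) 1).indicator 1 p.1) * (Ioo 0 π).indicator (fun θ => ENNReal.ofReal (sin θ) * g (cos θ)) p.2 := by
    rintro ⟨r, θ⟩ ⟨hr, hθ⟩
    simp only [mem_Ioi] at hr
    simp only [polarCoord_symm_apply, smul_eq_mul]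
    by_cases h : θ ∈ Ioo 0 π
    · have hs := sin_pos_of_pos_of_lt_pi h.1 h.2
      rw [indicator_of_mem (show r * sin θ ∈ Ioi 0 from mul_pos hr hs), indicator_of_mem h]
      simp only [hG]
      rw [show (r * cos θ)^2 + (r * sin θ)^2 = r^2 by nlinarith [sin_sq_add_cos_sq θ], Real.sqrt_sq hr.le,
        mul_div_cancel_left₀ _ hr.ne', ENNReal.ofReal_mul hr.le]
      ring
    · have hs : sin θ ≤ 0 := by
        apply sin_nonpos_of_nonpos_of_neg_pi_le _ hθ.1.le
        by_contra hc; push Not at hc; exact h ⟨hc, hθ.2⟩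
      rw [indicator_of_notMem (show r * sin θ ∉ Ioi 0 by simp only [mem_Ioi, not_lt]; exact mul_nonpos_of_nonneg_of_nonpos hr.le hs), indicator_of_notMem h]
      simp
  rw [setLIntegral_congr_fun (measurableSet_Ioi.prod measurableSet_Ioo) s4, Measure.volume_eq_prod, ← Measure.prod_restrict,
    lintegral_prod_mul (f := fun r => ENNReal.ofReal r * ENNReal.ofReal r * (Ioo (-1:ℝ) 1).indicator 1 r) (by fun_prop)
      (Measurable.aemeasurable (Measurable.indicator (by fun_prop) measurableSet_Ioo))]
  congr 1
  rw [← lint_cos, setLIntegral_indicator measurableSet_Ioo]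
  congr 2
  rw [inter_eq_left]
  exact Ioo_subset_Ioo_left (by linarith [pi_pos])

/-- Theorem of Archimedes. -/
lemma archimedes (g : ℝ → ℝ≥0∞) (hg : Measurable g) {v : E3} (h : ‖v‖ = 1) :
    ∫⁻ x, g ⟪x, v⟫ ∂sphereM = 2⁻¹ * ∫⁻ t in Ioo (-1) 1, g t := by
  obtain ⟨c, hc⟩ := zon_e1
  have h1 := sph_zon (fun _ => 1) measurable_const h
  rw [hc _ measurable_const] at h1
  simp only [lintegral_const, measure_univ, one_mul, Measure.restrict_apply_univ, Real.volume_Ioo] at h1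
  have h2 := sph_zon g hg h
  rw [hc g hg, h1] at h2
  have hv0 : volume (ball (0:E3) 1) ≠ 0 := (measure_ball_pos _ _ one_pos).ne'
  have hvt : volume (ball (0:E3) 1) ≠ ∞ := measure_ball_lt_top.ne
  rw [h1] at hv0 hvt
  norm_num at h2 hv0 hvt
  have hc0 : c ≠ 0 := hv0
  have hct : c ≠ ∞ := by rintro rfl; simp at hvt
  have h3 : c * ((∫⁻ x, g ⟪x, v⟫ ∂sphereM) * 2) = c * ∫⁻ t in Ioo (-1) 1, g t := by
    rw [← h2]; ring
  rw [ENNReal.mul_right_inj hc0 hct] at h3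
  rw [← h3, mul_comm _ (2:ℝ≥0∞), ← mul_assoc, ENNReal.inv_mul_cancel (by simp) (by simp), one_mul]

lemma lint_subst (h : ℝ → ℝ≥0∞) {R s : ℝ} (hR : 0 < R) (hs : 0 < s) :
    ∫⁻ t in Ioo (-1) 1, h (√(R^2 + s^2 - 2*R*s*t)) =
      ENNReal.ofReal (R*s)⁻¹ * ∫⁻ w in Ioo |R - s| (R + s), ENNReal.ofReal w * h w := by
  have hRs : 0 < R * s := mul_pos hR hs
  have him : (fun w : ℝ => (R^2 + s^2 - w^2) / (2*R*s)) '' Ioo |R - s| (R + s) = Ioo (-1) 1 := by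
    ext t; constructor
    · rintro ⟨w, ⟨h1, h2⟩, rfl⟩
      have h0 : 0 < w := (abs_nonneg _).trans_lt h1
      have h3 : (R - s)^2 < w^2 := by rw [← sq_abs (R-s)]; exact pow_lt_pow_left₀ h1 (abs_nonneg _) two_ne_zero
      constructor
      · rw [lt_div_iff₀ (by positivity)]; nlinarith
      · simp only; rw [div_lt_iff₀ (by positivity)]; nlinarith
    · rintro ⟨h1, h2⟩
      have hp : (R - s)^2 < R^2 + s^2 - 2*R*s*t := by nlinarith
      refine ⟨√(R^2 + s^2 - 2*R*s*t), ⟨?_, ?_⟩, ?_⟩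
      · exact Real.lt_sqrt_of_sq_lt (by rw [sq_abs]; exact hp)
      · rw [Real.sqrt_lt' (by positivity)]; nlinarith
      · simp only
        rw [Real.sq_sqrt (by nlinarith [sq_nonneg (R-s)])]
        field_simp; ring
  have hinj : InjOn (fun w : ℝ => (R^2 + s^2 - w^2) / (2*R*s)) (Ioo |R - s| (R + s)) := by
    intro w hw w' hw' e
    have h0 : 0 < w := (abs_nonneg _).trans_lt hw.1
    have h0' : 0 < w' := (abs_nonneg _).trans_lt hw'.1
    simp only at e
    rw [div_left_inj' (by positivity)] at e
    exact (pow_left_inj₀ h0.le h0'.le two_ne_zero).1 (by linarith)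
  have hd : ∀ w ∈ Ioo |R - s| (R + s), HasDerivWithinAt (fun w : ℝ => (R^2 + s^2 - w^2) / (2*R*s)) (-(2*w)/(2*R*s)) (Ioo |R - s| (R + s)) w := by
    intro w _
    have := (((hasDerivAt_id w).pow 2).const_sub (R^2+s^2)).div_const (2*R*s)
    simpa using this.hasDerivWithinAt
  rw [← him, lintegral_image_eq_lintegral_abs_deriv_mul measurableSet_Ioo hd hinj,
    ← lintegral_const_mul' _ _ ENNReal.ofReal_ne_top]
  refine setLIntegral_congr_fun measurableSet_Ioo fun w hw => ?_
  have h0 : 0 < w := (abs_nonneg _).trans_lt hw.1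
  rw [show R^2+s^2-2*R*s*((R^2 + s^2 - w^2) / (2*R*s)) = w^2 by field_simp; ring, Real.sqrt_sq h0.le, ← mul_assoc,
    ← ENNReal.ofReal_mul (by positivity)]
  congr 2
  rw [neg_div, abs_neg, abs_of_pos (by positivity)]
  field_simp

lemma sphere_dist (h : ℝ → ℝ≥0∞) (hh : Measurable h) {x : E3} (hx : x ≠ 0) {s : ℝ} (hs : 0 < s) :
    ∫⁻ u, h ‖x - s • u‖ ∂sphereM = 2⁻¹ * (ENNReal.ofReal (‖x‖*s)⁻¹ *
      ∫⁻ w in Ioo |‖x‖ - s| (‖x‖ + s), ENNReal.ofReal w * h w) := by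
  have hR : 0 < ‖x‖ := norm_pos_iff.2 hx
  rw [← lint_subst h hR hs, ← archimedes (fun t => h (√(‖x‖^2 + s^2 - 2*‖x‖*s*t))) (by fun_prop) (v := ‖x‖⁻¹ • x)
    (by rw [norm_smul, norm_inv, norm_norm, inv_mul_cancel₀ hR.ne'])]
  refine lintegral_congr_ae ?_
  filter_upwards [sphereM_ae] with u hu
  congr 1
  rw [← Real.sqrt_sq (norm_nonneg (x - s • u))]
  congr 1
  rw [norm_sub_sq_real, norm_smul, hu, inner_smul_right, inner_smul_right, real_inner_comm x u, Real.norm_eq_abs, mul_one, sq_abs]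
  field_simp
  ring

/-- Theorem of Newton. -/
lemma newton (x : E3) {s : ℝ} (hs : 0 < s) :
    ∫⁻ u, (ENNReal.ofReal ‖x - s • u‖)⁻¹ ∂sphereM = ENNReal.ofReal (max ‖x‖ s)⁻¹ := by
  rcases eq_or_ne x 0 with rfl | hx
  · have : ∫⁻ u, (ENNReal.ofReal ‖(0:E3) - s • u‖)⁻¹ ∂sphereM = ∫⁻ u, ENNReal.ofReal s⁻¹ ∂sphereM := by
      refine lintegral_congr_ae ?_
      filter_upwards [sphereM_ae] with u hu
      simp [norm_smul, hu, abs_of_pos hs, ENNReal.ofReal_inv_of_pos hs]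
    rw [this, norm_zero, max_eq_right hs.le]; simp
  · have hR : 0 < ‖x‖ := norm_pos_iff.2 hx
    rw [sphere_dist (fun r => (ENNReal.ofReal r)⁻¹) (by fun_prop) hx hs]
    have : ∫⁻ w in Ioo |‖x‖ - s| (‖x‖ + s), ENNReal.ofReal w * (ENNReal.ofReal w)⁻¹ = 
        ∫⁻ w in Ioo |‖x‖ - s| (‖x‖ + s), 1 := by
      refine setLIntegral_congr_fun measurableSet_Ioo fun w hw => ?_
      have h0 : 0 < w := (abs_nonneg _).trans_lt hw.1
      exact ENNReal.mul_inv_cancel (by simpa using h0) ENNReal.ofReal_ne_top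
    rw [this, setLIntegral_const, one_mul, Real.volume_Ioo,
      show (2:ℝ≥0∞)⁻¹ = ENNReal.ofReal 2⁻¹ by rw [ENNReal.ofReal_inv_of_pos two_pos]; simp,
      ← ENNReal.ofReal_mul (by positivity), ← ENNReal.ofReal_mul (by positivity)]
    congr 1
    rcases le_total ‖x‖ s with h | h
    · rw [max_eq_right h, abs_of_nonpos (by linarith)]; field_simp; ring
    · rw [max_eq_left h, abs_of_nonneg (by linarith)]; field_simp; ring

def HH (b w : ℝ) : ℝ := w + (max (1 - b * w) 0)^2 / (2*b)

lemma hasDerivAt_pos_sq (x : ℝ) : HasDerivAt (fun x : ℝ => (max x 0)^2) (2 * max x 0) x := by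
  rcases lt_trichotomy x 0 with h | rfl | h
  · rw [max_eq_right h.le]
    have : (fun x : ℝ => (max x 0)^2) =ᶠ[𝓝 x] fun _ => 0 := by
      filter_upwards [Iio_mem_nhds h] with y hy
      rw [max_eq_right (le_of_lt hy)]; simp
    simpa using (hasDerivAt_const x (0:ℝ)).congr_of_eventuallyEq this
  · rw [hasDerivAt_iff_isLittleO]
    simp only [max_self, mul_zero, smul_zero, sub_zero]
    rw [Asymptotics.isLittleO_iff]
    intro c hc
    filter_upwards [Metric.ball_mem_nhds (0:ℝ) hc] with y hy
    have hy' : |y| < c := by simpa using hy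
    simp only [ne_eq, OfNat.ofNat_ne_zero, not_false_eq_true, zero_pow, sub_zero, norm_pow, Real.norm_eq_abs]
    have h1 : |max y 0| ≤ |y| := by
      rw [abs_of_nonneg (le_max_right _ _)]; exact max_le (le_abs_self _) (abs_nonneg _)
    nlinarith [abs_nonneg y, abs_nonneg (max y 0)]
  · rw [max_eq_left h.le]
    have : (fun x : ℝ => (max x 0)^2) =ᶠ[𝓝 x] fun x => x^2 := by
      filter_upwards [Ioi_mem_nhds h] with y hy
      rw [max_eq_left (le_of_lt hy)]
    simpa using (hasDerivAt_pow 2 x).congr_of_eventuallyEq this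

lemma HH_deriv {b : ℝ} (hb : 0 < b) (w : ℝ) : HasDerivAt (HH b) (min 1 (b*w)) w := by
  have h1 : HasDerivAt (fun w : ℝ => 1 - b * w) (-b) w := by
    simpa using ((hasDerivAt_id w).const_mul b).const_sub 1
  have h2 := (hasDerivAt_id w).add (((hasDerivAt_pos_sq (1 - b*w)).comp w h1).div_const (2*b))
  have h3 : HasDerivAt (HH b) (1 + 2 * max (1 - b*w) 0 * (-b) / (2*b)) w := h2
  convert h3 using 1
  rcases le_total 1 (b*w) with h | h
  · rw [min_eq_left h, max_eq_right (by linarith)]; simp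
  · rw [min_eq_right h, max_eq_left (by linarith)]; field_simp; ring

lemma HH_sub {b : ℝ} (hb : 0 < b) (p q : ℝ) : HH b q - HH b p = ∫ w in p..q, min 1 (b*w) :=
  (intervalIntegral.integral_eq_sub_of_hasDerivAt (fun w _ => HH_deriv hb w)
      (Continuous.intervalIntegrable (by fun_prop) _ _)).symm

lemma HH_le {b : ℝ} (hb : 0 < b) {p q : ℝ} (hp : 0 ≤ p) (hpq : p ≤ q) : 0 ≤ HH b q - HH b p := by
  rw [HH_sub hb]
  refine intervalIntegral.integral_nonneg hpq fun u hu => ?_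
  have : 0 ≤ u := hp.trans hu.1
  positivity

lemma DD_eq {a b : ℝ} (ha : 0 < a) (hb : 0 < b) :
    DD (dilate sphereM 0 a) (dilate sphereM e1 b) =
      2⁻¹ * ENNReal.ofReal (a / 2 * (HH b (1 + a⁻¹) - HH b |1 - a⁻¹|)) := by
  unfold DD
  congr 1
  have hm : ∀ (v : E3) (c : ℝ), Measurable (fun u : E3 => v + c • u) := fun v c => by fun_prop
  have hcm : Measurable (fun p : E3 × E3 => coul p.1 p.2) := by unfold coul; fun_prop
  have h1 : ∀ x, ∫⁻ y, coul x y ∂(dilate sphereM e1 b) = ENNReal.ofReal (max ‖x - e1‖ b⁻¹)⁻¹ := by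
    intro x
    unfold dilate
    rw [lintegral_map (f := fun y => coul x y) (hcm.comp (f := fun y => (x, y)) (by fun_prop)) (hm _ _), ← newton _ (inv_pos.2 hb)]
    refine lintegral_congr fun u => ?_
    unfold coul
    rw [sub_add_eq_sub_sub]
  simp only [h1]
  unfold dilate
  rw [lintegral_map (by fun_prop) (hm _ _)]
  have h2 : ∀ u : E3, ENNReal.ofReal (max ‖0 + a⁻¹ • u - e1‖ b⁻¹)⁻¹ = ENNReal.ofReal (max ‖e1 - a⁻¹ • u‖ b⁻¹)⁻¹ := by
    intro u
    rw [zero_add, norm_sub_rev]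
  simp only [h2]
  have he : e1 ≠ 0 := by intro h; have := norm_e1; rw [h] at this; simp at this
  rw [sphere_dist (fun r => ENNReal.ofReal (max r b⁻¹)⁻¹) (by fun_prop) he (inv_pos.2 ha), norm_e1]
  have hle : |1 - a⁻¹| ≤ 1 + a⁻¹ := by
    have := inv_pos.2 ha
    rw [abs_le]; constructor <;> linarith
  have h3 : ∫⁻ w in Ioo |1 - a⁻¹| (1 + a⁻¹), ENNReal.ofReal w * ENNReal.ofReal (max w b⁻¹)⁻¹
      = ENNReal.ofReal (HH b (1 + a⁻¹) - HH b |1 - a⁻¹|) := by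
    rw [HH_sub hb, intervalIntegral.integral_of_le hle, integral_Ioc_eq_integral_Ioo,
      ofReal_integral_eq_lintegral_ofReal]
    · refine setLIntegral_congr_fun measurableSet_Ioo fun w hw => ?_
      have h0 : 0 < w := (abs_nonneg _).trans_lt hw.1
      rw [← ENNReal.ofReal_mul h0.le]
      congr 1
      have hb1 : b * b⁻¹ = 1 := mul_inv_cancel₀ hb.ne'
      rcases le_total w b⁻¹ with h | h
      · rw [max_eq_right h, inv_inv, min_eq_right (by nlinarith)]; ring
      · rw [max_eq_left h, min_eq_left (by nlinarith)]; exact mul_inv_cancel₀ h0.ne'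
    · have : Continuous (fun w : ℝ => min 1 (b*w)) := by fun_prop
      exact (this.integrableOn_Icc).mono_set Ioo_subset_Icc_self
    · filter_upwards [ae_restrict_mem measurableSet_Ioo] with w hw
      have h0 : 0 < w := (abs_nonneg _).trans_lt hw.1
      simp only [Pi.zero_apply]
      positivity
  rw [h3, show (2:ℝ≥0∞)⁻¹ = ENNReal.ofReal 2⁻¹ by rw [ENNReal.ofReal_inv_of_pos two_pos]; simp,
      ← ENNReal.ofReal_mul (by positivity), ← ENNReal.ofReal_mul (by positivity)]
  congr 1
  simp; ring

lemma max_scale {a x y : ℝ} (ha : 0 < a) (h : x = y / a) : max x 0 = max y 0 / a := by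
  rw [h]
  rcases le_total y 0 with h | h
  · rw [max_eq_right h, max_eq_right (div_nonpos_of_nonpos_of_nonneg h ha.le), zero_div]
  · rw [max_eq_left h, max_eq_left (by positivity)]

lemma alg_case {a b : ℝ} (ha : 0 < a) (hb : 0 < b) :
    4*a*b*(1 - (a + 1 - |a-1|)/2) - (max (a - a*b - b) 0)^2 + (max (a - b*|a-1|) 0)^2
      = (max (a + b - a * b) 0) ^ 2 - (max (|a - b| - a * b) 0) ^ 2 := by
  have hab : 0 < a * b := mul_pos ha hb
  rcases le_total 1 a with h1 | h1
  · rw [abs_of_nonneg (show 0 ≤ a - 1 by linarith), show a - b*(a-1) = a + b - a*b by ring]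
    have : max (a - a*b - b) 0 = max (|a-b| - a*b) 0 := by
      rcases le_total b a with h | h
      · rw [abs_of_nonneg (by linarith)]; congr 1; ring
      · rw [abs_of_nonpos (by linarith), max_eq_right (by nlinarith), max_eq_right (by nlinarith)]
    rw [this]; ring
  · rw [abs_of_nonpos (show a - 1 ≤ 0 by linarith), max_eq_left (show 0 ≤ a + b - a*b by nlinarith)]
    rcases le_total b a with h | h
    · rw [abs_of_nonneg (show 0 ≤ a - b by linarith), show a - a*b - b = a - b - a*b by ring,
        max_eq_left (show 0 ≤ a - b * -(a-1) by nlinarith)]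
      ring
    · rw [abs_of_nonpos (show a - b ≤ 0 by linarith), max_eq_right (show a - a*b - b ≤ 0 by nlinarith)]
      rcases le_total (b - a - a*b) 0 with h2 | h2
      · rw [max_eq_right (show -(a-b) - a*b ≤ 0 by linarith), max_eq_left (show 0 ≤ a - b * -(a-1) by nlinarith)]
        ring
      · rw [max_eq_left (show 0 ≤ -(a-b) - a*b by linarith), max_eq_right (show a - b * -(a-1) ≤ 0 by nlinarith)]
        ring

lemma Phi_eq {a b : ℝ} (ha : 0 ≤ a) (hb : 0 ≤ b) : Phi sphereM sphereM a b =
        a ^ 2 * b ^ 2 / 4 *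
          ((max (a + b - a * b) 0) ^ 2 - (max (|a - b| - a * b) 0) ^ 2) := by
  rcases ha.eq_or_lt with rfl | ha
  · simp [Phi]
  rcases hb.eq_or_lt with rfl | hb
  · simp [Phi]
  have hle : |1 - a⁻¹| ≤ 1 + a⁻¹ := by
    have := inv_pos.2 ha
    rw [abs_le]; constructor <;> linarith
  have h0 := HH_le hb (abs_nonneg (1 - a⁻¹)) hle
  rw [Phi, if_pos ⟨ha, hb⟩, Dr, DD_eq ha hb, ENNReal.toReal_mul, ENNReal.toReal_ofReal (by positivity),
    ← alg_case ha hb]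
  have e1 : |1 - a⁻¹| = |a - 1| / a := by
    rw [show 1 - a⁻¹ = (a-1)/a by field_simp, abs_div, abs_of_pos ha]
  unfold HH
  rw [e1, max_scale (y := a - a*b - b) ha (by field_simp; ring), max_scale (x := 1 - b * (|a-1|/a)) (y := a - b*|a-1|) ha (by field_simp)]
  simp only [ENNReal.toReal_inv, ENNReal.toReal_ofNat]
  field_simp
  ring

def pp (x : ℝ) : ℝ := (max x 0)^2

lemma pp_deriv (x : ℝ) : HasDerivAt pp (2 * max x 0) x := hasDerivAt_pos_sq x

lemma pp_contDiff : ContDiff ℝ 1 pp := by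
  rw [contDiff_one_iff_deriv]
  refine ⟨fun x => (pp_deriv x).differentiableAt, ?_⟩
  rw [show deriv pp = fun x => 2 * max x 0 from funext fun x => (pp_deriv x).deriv]
  fun_prop

def FF (p : ℝ × ℝ) : ℝ := p.1^2 * p.2^2 / 4 *
  (pp (p.1 + p.2 - p.1*p.2) - pp (p.1 - p.2 - p.1*p.2) - pp (p.2 - p.1 - p.1*p.2))

lemma FF_contDiff : ContDiff ℝ 1 FF := by
  unfold FF
  have h1 := pp_contDiff.comp (f := fun p : ℝ × ℝ => p.1 + p.2 - p.1*p.2) (by fun_prop)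
  have h2 := pp_contDiff.comp (f := fun p : ℝ × ℝ => p.1 - p.2 - p.1*p.2) (by fun_prop)
  have h3 := pp_contDiff.comp (f := fun p : ℝ × ℝ => p.2 - p.1 - p.1*p.2) (by fun_prop)
  exact ContDiff.mul (by fun_prop) ((h1.sub h2).sub h3)

lemma FF_symm (p : ℝ × ℝ) : FF p = FF p.swap := by
  simp only [FF, Prod.fst_swap, Prod.snd_swap]
  rw [show p.2 + p.1 - p.2*p.1 = p.1 + p.2 - p.1*p.2 by ring,
    show p.1 - p.2 - p.2*p.1 = p.1 - p.2 - p.1*p.2 by ring,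
    show p.2 - p.1 - p.2*p.1 = p.2 - p.1 - p.1*p.2 by ring]
  ring

lemma FF_eq {a b : ℝ} (ha : 0 ≤ a) (hb : 0 ≤ b) : Phi sphereM sphereM a b = FF (a, b) := by
  rw [Phi_eq ha hb]
  simp only [FF, pp]
  have hab : 0 ≤ a * b := mul_nonneg ha hb
  rcases le_total b a with h | h
  · rw [abs_of_nonneg (by linarith), max_eq_right (show b - a - a*b ≤ 0 by linarith)]; ring
  · rw [abs_of_nonpos (by linarith), max_eq_right (show a - b - a*b ≤ 0 by linarith), neg_sub]; ring

lemma FF_partial (a b : ℝ) : HasDerivAt (fun t => FF (t, b))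
    (a * b^2 / 2 * (pp (a + b - a*b) - pp (a - b - a*b) - pp (b - a - a*b)) +
      a^2 * b^2 / 4 * (2 * max (a + b - a*b) 0 * (1 - b) - 2 * max (a - b - a*b) 0 * (1 - b)
        - 2 * max (b - a - a*b) 0 * (-1 - b))) a := by
  have hm : HasDerivAt (fun t : ℝ => t * b) b a := by simpa using (hasDerivAt_id a).mul_const b
  have i1 : HasDerivAt (fun t : ℝ => t + b - t * b) (1 - b) a := ((hasDerivAt_id a).add_const b).sub hm
  have i2 : HasDerivAt (fun t : ℝ => t - b - t * b) (1 - b) a := ((hasDerivAt_id a).sub_const b).sub hm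
  have i3 : HasDerivAt (fun t : ℝ => b - t - t * b) (-1 - b) a := ((hasDerivAt_id a).const_sub b).sub hm
  have j1 := (pp_deriv _).comp a i1
  have j2 := (pp_deriv _).comp a i2
  have j3 := (pp_deriv _).comp a i3
  have k : HasDerivAt (fun t : ℝ => t^2 * b^2 / 4) (a * b^2 / 2) a := by
    have := (((hasDerivAt_pow 2 a).mul_const (b^2)).div_const 4)
    refine this.congr_deriv ?_
    norm_num
    ring
  exact k.mul ((j1.sub j2).sub j3)

lemma FF_partial_bound {a b : ℝ} (ha : 0 ≤ a) (hb : 0 ≤ b) :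
    |a * b^2 / 2 * (pp (a + b - a*b) - pp (a - b - a*b) - pp (b - a - a*b)) +
      a^2 * b^2 / 4 * (2 * max (a + b - a*b) 0 * (1 - b) - 2 * max (a - b - a*b) 0 * (1 - b)
        - 2 * max (b - a - a*b) 0 * (-1 - b))| ≤ 10 * (a ^ 2 * b ^ 3 + a ^ 3 * b ^ 2) := by
  have hab : 0 ≤ a * b := mul_nonneg ha hb
  simp only [pp]
  set p := max (a + b - a*b) 0 with hp
  set r := max (a - b - a*b) 0 with hr
  set q := max (b - a - a*b) 0 with hq
  have p0 : 0 ≤ p := le_max_right _ _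
  have r0 : 0 ≤ r := le_max_right _ _
  have q0 : 0 ≤ q := le_max_right _ _
  have hpab : p ≤ a + b := max_le (by linarith) (by linarith)
  have hqp : q ≤ p := max_le_max_right _ (by linarith)
  have hpq : p - q ≤ 2 * a := by
    have : p ≤ q + 2*a := max_le (by linarith [le_max_left (b - a - a*b) 0]) (by linarith)
    linarith
  have hra : r ≤ a := max_le (by linarith) ha
  have hbpq : b * (p - q) ≤ 2 * (a + b) := by
    rcases le_total (a + b - a*b) 0 with h | h
    · have : p = 0 := max_eq_right h
      have : q = 0 := by linarith
      nlinarith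
    · nlinarith
  have hbpq0 : 0 ≤ b * (p - q) := mul_nonneg hb (by linarith)
  have hrb : |r * (1 - b)| ≤ a := by
    rcases le_total b 1 with h | h
    · rw [abs_of_nonneg (by nlinarith)]; nlinarith
    · have : r = 0 := max_eq_right (by nlinarith)
      rw [this]; simpa using ha
  have hQ : |p^2 - r^2 - q^2| ≤ 5 * (a * (a + b)) := by
    have h1 : (p - q) * (p + q) ≤ (2 * a) * (2 * (a + b)) :=
      mul_le_mul hpq (by linarith) (by linarith) (by linarith)
    have h2 : 0 ≤ (p - q) * (p + q) := mul_nonneg (by linarith) (by linarith)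
    have h3 : r^2 ≤ a^2 := pow_le_pow_left₀ r0 hra 2
    rw [abs_le]; constructor <;> nlinarith
  have hD : |2 * p * (1 - b) - 2 * r * (1 - b) - 2 * q * (-1 - b)| ≤ 10 * (a + b) := by
    rw [show 2 * p * (1 - b) - 2 * r * (1 - b) - 2 * q * (-1 - b) = 2 * (p + q) - 2 * (b * (p - q)) - 2 * (r * (1 - b)) by ring]
    rw [abs_le] at hrb ⊢
    constructor <;> linarith [hrb.1, hrb.2]
  refine (abs_add_le _ _).trans ?_
  rw [abs_mul, abs_mul (a^2*b^2/4), abs_of_nonneg (show 0 ≤ a * b^2 / 2 by positivity), abs_of_nonneg (show 0 ≤ a^2 * b^2 / 4 by positivity)]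
  have m1 := mul_le_mul_of_nonneg_left hQ (show 0 ≤ a * b^2 / 2 by positivity)
  have m2 := mul_le_mul_of_nonneg_left hD (show 0 ≤ a^2 * b^2 / 4 by positivity)
  have m3 : 0 ≤ a^2 * b^3 + a^3 * b^2 := by positivity
  nlinarith

lemma FF_fderiv_fst {a b : ℝ} (ha : 0 ≤ a) (hb : 0 ≤ b) :
    |fderiv ℝ FF (a, b) (1, 0)| ≤ 10 * (a ^ 2 * b ^ 3 + a ^ 3 * b ^ 2) := by
  have hd : HasFDerivAt FF (fderiv ℝ FF (a, b)) (a, b) := (FF_contDiff.differentiable one_ne_zero _).hasFDerivAt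
  have h := hd.comp_hasDerivAt (f := fun t : ℝ => (t, b)) a ((hasDerivAt_id a).prodMk (hasDerivAt_const a b))
  rw [h.unique (FF_partial a b)]
  exact FF_partial_bound ha hb

lemma FF_fderiv_snd {a b : ℝ} (ha : 0 ≤ a) (hb : 0 ≤ b) :
    |fderiv ℝ FF (a, b) (0, 1)| ≤ 10 * (a ^ 2 * b ^ 3 + a ^ 3 * b ^ 2) := by
  have hd : HasFDerivAt FF (fderiv ℝ FF (a, b)) (a, b) := (FF_contDiff.differentiable one_ne_zero _).hasFDerivAt
  have h := hd.comp_hasDerivAt (f := fun t : ℝ => (a, t)) b ((hasDerivAt_const b a).prodMk (hasDerivAt_id b))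
  have e : (FF ∘ fun t : ℝ => (a, t)) = fun t => FF (t, a) := funext fun t => FF_symm (a, t)
  rw [e] at h
  rw [h.unique (FF_partial b a)]
  refine (FF_partial_bound hb ha).trans (le_of_eq ?_)
  ring

lemma Psi_eq_FF {a b : ℝ} (ha : 0 ≤ a) (hb : 0 ≤ b) : Psi sphereM sphereM a b = FF (a, b) := by
  rw [← FF_eq ha hb, Psi]; ring

/-- **Case of the sphere** (Lemma 1 of the paper): for `σ` the uniform probability measure on
the unit sphere, `Ψ_{σσ}(a,b) = Φ_{σσ}(a,b) = (a²b²/4)((a+b-ab)₊² - (|a-b|-ab)₊²)`; in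
particular `Ψ_{σσ}` is `C¹` on `[0,∞)²` with `|∇Ψ_{σσ}(a,b)| ≤ C(a²b³ + a³b²)`. -/
theorem Psi_sphere :
    (∀ a b : ℝ, 0 ≤ a → 0 ≤ b →
      Psi sphereM sphereM a b = Phi sphereM sphereM a b ∧
      Phi sphereM sphereM a b =
        a ^ 2 * b ^ 2 / 4 *
          ((max (a + b - a * b) 0) ^ 2 - (max (|a - b| - a * b) 0) ^ 2)) ∧
    ContDiffOn ℝ 1 (fun p : ℝ × ℝ => Psi sphereM sphereM p.1 p.2) (Ici 0 ×ˢ Ici 0) ∧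
    ∃ C : ℝ, ∀ a b : ℝ, 0 ≤ a → 0 ≤ b →
      ‖fderivWithin ℝ (fun p : ℝ × ℝ => Psi sphereM sphereM p.1 p.2)
          (Ici 0 ×ˢ Ici 0) (a, b)‖ ≤ C * (a ^ 2 * b ^ 3 + a ^ 3 * b ^ 2) := by
  have hE : EqOn (fun p : ℝ × ℝ => Psi sphereM sphereM p.1 p.2) FF (Ici 0 ×ˢ Ici 0) :=
    fun p hp => Psi_eq_FF hp.1 hp.2
  refine ⟨fun a b ha hb => ⟨by rw [Psi]; ring, Phi_eq ha hb⟩, FF_contDiff.contDiffOn.congr hE, 20, ?_⟩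
  intro a b ha hb
  have hU : UniqueDiffOn ℝ (Ici (0:ℝ) ×ˢ Ici (0:ℝ)) := (uniqueDiffOn_Ici 0).prod (uniqueDiffOn_Ici 0)
  have hmem : (a, b) ∈ Ici (0:ℝ) ×ˢ Ici (0:ℝ) := ⟨ha, hb⟩
  rw [fderivWithin_congr hE (hE hmem), fderivWithin_eq_fderiv (hU _ hmem) (FF_contDiff.differentiable one_ne_zero _)]
  refine ContinuousLinearMap.opNorm_le_bound _ (by positivity) fun v => ?_
  have hv : v = v.1 • ((1, 0) : ℝ × ℝ) + v.2 • ((0, 1) : ℝ × ℝ) := by ext <;> simp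
  have h1 := FF_fderiv_fst ha hb
  have h2 := FF_fderiv_snd ha hb
  have n1 : |v.1| ≤ ‖v‖ := norm_fst_le v
  have n2 : |v.2| ≤ ‖v‖ := norm_snd_le v
  conv_lhs => rw [hv]
  rw [map_add, map_smul, map_smul, smul_eq_mul, smul_eq_mul, Real.norm_eq_abs]
  refine (abs_add_le _ _).trans ?_
  rw [abs_mul, abs_mul]
  have m1 := mul_le_mul n1 h1 (abs_nonneg _) (norm_nonneg _)
  have m2 := mul_le_mul n2 h2 (abs_nonneg _) (norm_nonneg _)
  linarith
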